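/- Suppose n ≠ 0, let β ∈ L' be isotropic, let χ be a ℂ-valued Dirichlet character modulo N_β, let g = gcd(N_β, N_β(γ,β)), and let N_γ be the order of γ + ℤ^m in L'/ℤ^m. For each prime p set w_p = 1 + 2·ν_p(2N_βN_γn) and define the polynomial L^{(p)}_{γ,n}(X) = N_{γ,n}(p^{w_p})·X^{w_p} + (1 − p^{m−1}X)·∑_{ν=0}^{w_p−1} N_{γ,n}(p^ν)·X^ν. Then for every complex s with Re(s) > m + 1, both sides of the following identity converge absolutely and are equal: ∑_{c ≥ 1, gcd(c,g)=1} χ(c) · c^{−s} · ∑_{a | c} μ(c/a) · a^{1−m} · N_{γ,n}(a) = ∏_{p prime, p ∤ g} L^{(p)}_{γ,n}(χ(p)·p^{1−m−s}). -/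

import Mathlib

open Finset Matrix

namespace EisensteinWeil

variable {m : ℕ}

/-- The bilinear form `(x,y) = xᵀ S y` on `ℚ^m`. -/
def bil (S : Matrix (Fin m) (Fin m) ℤ) (x y : Fin m → ℚ) : ℚ :=
  x ⬝ᵥ (S.map (Int.cast : ℤ → ℚ)).mulVec y

/-- The quadratic form `Q(x) = (x,x)/2`. -/
def Qf (S : Matrix (Fin m) (Fin m) ℤ) (x : Fin m → ℚ) : ℚ := bil S x x / 2

/-- Membership in the dual lattice `L' = S⁻¹ℤ^m`: `x ∈ L'` iff `(x,r) ∈ ℤ` for all `r ∈ ℤ^m`. -/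
def memDual (S : Matrix (Fin m) (Fin m) ℤ) (γ : Fin m → ℚ) : Prop :=
  ∀ r : Fin m → ℤ, ∃ z : ℤ, bil S γ (fun i => (r i : ℚ)) = z

/-- `N` is the order of `γ + ℤ^m` in `L'/ℤ^m`, i.e. the smallest positive integer with
`N • γ ∈ ℤ^m`. -/
def isOrderOf (γ : Fin m → ℚ) (N : ℕ) : Prop :=
  0 < N ∧ (∀ i, ∃ z : ℤ, (N : ℚ) * γ i = z) ∧
    ∀ k : ℕ, 0 < k → (∀ i, ∃ z : ℤ, (k : ℚ) * γ i = z) → N ≤ k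

/-- The representation number `N_{γ,n}(a)`, counting `r ∈ (ℤ^m)/(aℤ^m)`
(represented by `r : Fin m → Fin a`) with `Q(r − γ) + n ≡ 0 (mod a)`. -/
noncomputable def repNum (S : Matrix (Fin m) (Fin m) ℤ) (γ : Fin m → ℚ) (n : ℚ) (a : ℕ) : ℕ :=
  Nat.card {r : Fin m → Fin a //
    ∃ t : ℤ, Qf S ((fun i => ((r i : ℕ) : ℚ)) - γ) + n = (a : ℚ) * t}

/-- `e(x) = e^{2πix}`. -/
noncomputable def eQ (x : ℚ) : ℂ := Complex.exp (2 * Real.pi * Complex.I * (x : ℂ))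

/-- A canonical choice of inverse of `d` modulo `c`. -/
def adInv (c d : ℕ) : ℕ := ((d : ZMod c)⁻¹).val

/-- The sum `G_{γ,n}(c; β, χ)`. -/
noncomputable def Gsum (S : Matrix (Fin m) (Fin m) ℤ) (γ : Fin m → ℚ) (n : ℚ)
    (β : Fin m → ℚ) (Nβ : ℕ) (χ : DirichletCharacter ℂ Nβ) (c : ℕ) : ℂ :=
  ∑ ν ∈ (range Nβ).filter (fun ν => Nat.Coprime ν Nβ), χ (ν : ZMod Nβ) *
    ∑ d ∈ (range c).filter (fun d => Nat.Coprime d c),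
      ∑ r ∈ Fintype.piFinset (fun _ : Fin m => range c),
        eQ (((adInv c d : ℚ) * Qf S (ν • β + fun i => (r i : ℚ))
            - bil S γ (ν • β + fun i => (r i : ℚ))
            + (d : ℚ) * (Qf S γ + n)) / c)

/-- The Gauss sum `G(χ) = ∑_{u mod N, gcd(u,N)=1} χ(u) e(u/N)`. -/
noncomputable def gaussS (N : ℕ) (χ : DirichletCharacter ℂ N) : ℂ :=
  ∑ u ∈ (range N).filter (fun u => Nat.Coprime u N), χ (u : ZMod N) * eQ (u / N)


/-- The polynomial `L^{(p)}(X) = N_{γ,n}(p^w)X^w + (1 − p^{m−1}X)∑_{ν=0}^{w−1} N_{γ,n}(p^ν)X^ν`,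
evaluated at `X : ℂ`. -/
noncomputable def Lpoly (S : Matrix (Fin m) (Fin m) ℤ) (γ : Fin m → ℚ) (n : ℚ)
    (p w : ℕ) (X : ℂ) : ℂ :=
  (repNum S γ n (p ^ w) : ℂ) * X ^ w +
    (1 - (p : ℂ) ^ (m - 1) * X) * ∑ ν ∈ range w, (repNum S γ n (p ^ ν) : ℂ) * X ^ ν

/-- The reduction modulo `a` of an integer-valued function on `ℤ^m`. -/
def modRed (f : (Fin m → ℤ) → ℤ) (a : ℕ) (r : Fin m → ZMod a) : ZMod a :=
  ((f fun i => ((r i).cast : ℤ) : ℤ) : ZMod a)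

/-- The number of zeros modulo `a` of an integer-valued function on `ℤ^m`. -/
noncomputable def zeroCount (f : (Fin m → ℤ) → ℤ) (a : ℕ) : ℕ :=
  Nat.card {r : Fin m → ZMod a // modRed f a r = 0}

lemma modRed_intCast {f : (Fin m → ℤ) → ℤ} (hf : ∀ r u a, a ∣ f (r + a • u) - f r)
    (a : ℕ) (z : Fin m → ℤ) : modRed f a (fun i => (z i : ZMod a)) = (f z : ZMod a) := by
  have h : ∀ i, ∃ u : ℤ, (((z i : ZMod a)).cast : ℤ) = z i + a * u := fun i => by
    have h1 : (((((z i : ZMod a)).cast : ℤ)) : ZMod a) = (z i : ZMod a) := ZMod.intCast_zmod_cast _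
    rw [eq_comm, ZMod.intCast_eq_intCast_iff_dvd_sub] at h1
    obtain ⟨u, hu⟩ := h1
    exact ⟨u, by linarith⟩
  choose u hu using h
  unfold modRed
  have h2 : (fun i => (((z i : ZMod a)).cast : ℤ)) = z + (a : ℤ) • u := by
    ext i; simp [hu]
  rw [h2, eq_comm, ZMod.intCast_eq_intCast_iff_dvd_sub]
  exact hf _ _ _

lemma exists_int_lift (a : ℕ) (r : Fin m → ZMod a) :
    ∃ z : Fin m → ℤ, r = fun i => (z i : ZMod a) :=
  ⟨fun i => (r i).cast, by ext i; simp⟩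

lemma zeroCount_one (f : (Fin m → ℤ) → ℤ) : zeroCount f 1 = 1 := by
  unfold zeroCount
  rw [Nat.card_eq_one_iff_unique]
  exact ⟨⟨fun x y => Subtype.ext (Subsingleton.elim _ _)⟩, ⟨⟨0, Subsingleton.elim _ _⟩⟩⟩

lemma zeroCount_le (f : (Fin m → ℤ) → ℤ) (a : ℕ) (ha : a ≠ 0) : zeroCount f a ≤ a ^ m := by
  have : NeZero a := ⟨ha⟩
  unfold zeroCount
  calc _ ≤ Nat.card (Fin m → ZMod a) := Finite.card_subtype_le _
    _ = a ^ m := by simp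

lemma zeroCount_mul {f : (Fin m → ℤ) → ℤ} (hf : ∀ r u a, a ∣ f (r + a • u) - f r)
    {a b : ℕ} (hab : a.Coprime b) : zeroCount f (a * b) = zeroCount f a * zeroCount f b := by
  unfold zeroCount
  rw [← Nat.card_prod]
  let e : (Fin m → ZMod (a * b)) ≃ (Fin m → ZMod a) × (Fin m → ZMod b) :=
    (Equiv.piCongrRight fun _ => (ZMod.chineseRemainder hab).toEquiv).trans
      (Equiv.arrowProdEquivProdArrow _ _ _)
  refine Nat.card_congr ((e.subtypeEquiv (q := fun x => modRed f a x.1 = 0 ∧ modRed f b x.2 = 0)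
    fun r => ?_).trans (Equiv.subtypeProdEquivProd
      (p := fun x => modRed f a x = 0) (q := fun x => modRed f b x = 0)))
  obtain ⟨z, rfl⟩ := exists_int_lift _ r
  have h1 : e (fun i => (z i : ZMod (a * b))) = (fun i => (z i : ZMod a), fun i => (z i : ZMod b)) := by
    have : ∀ i, (ZMod.chineseRemainder hab) (z i : ZMod (a * b)) = ((z i : ZMod a), (z i : ZMod b)) :=
      fun i => by rw [map_intCast]; rfl
    ext i
    · exact congrArg Prod.fst (this i)
    · exact congrArg Prod.snd (this i)
  rw [h1]
  simp only [modRed_intCast hf, ZMod.intCast_zmod_eq_zero_iff_dvd]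
  push_cast
  exact ⟨fun h => ⟨(Dvd.intro _ rfl).trans h, (Dvd.intro_left _ rfl).trans h⟩,
    fun h => (Nat.isCoprime_iff_coprime.2 hab).mul_dvd h.1 h.2⟩

lemma card_subtype_comp_mul_card {G H : Type*} [AddGroup G] [AddGroup H]
    (π : G →+ H) (hπ : Function.Surjective π) (P : H → Prop) :
    Nat.card {g // P (π g)} * Nat.card H = Nat.card {h // P h} * Nat.card G := by
  choose σ hσ using hπ
  let e : G ≃ H × π.ker :=
    { toFun := fun g => (π g, ⟨g - σ (π g), by simp [AddMonoidHom.mem_ker, hσ]⟩)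
      invFun := fun x => x.2 + σ x.1
      left_inv := fun g => by simp
      right_inv := fun x => by
        have : π x.2 = 0 := x.2.2
        ext <;> simp [this, hσ] }
  have h1 : Nat.card G = Nat.card H * Nat.card π.ker := by
    rw [Nat.card_congr e, Nat.card_prod]
  have h2 : Nat.card {g // P (π g)} = Nat.card {h // P h} * Nat.card π.ker := by
    rw [← Nat.card_prod]
    exact Nat.card_congr ((e.subtypeEquiv (q := fun x => P x.1) fun g => Iff.rfl).trans
      Equiv.prodSubtypeFstEquivSubtypeProd)
  rw [h1, h2]; ring

/-- Lifting zeros modulo `a` to residues modulo a multiple `a * b`. -/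
lemma card_dvd_eq_pow_mul_zeroCount {f : (Fin m → ℤ) → ℤ}
    (hf : ∀ r u a, a ∣ f (r + a • u) - f r) (a b : ℕ) (ha : a ≠ 0) :
    Nat.card {r : Fin m → ZMod (a * b) // (a : ZMod (a * b)) ∣ modRed f (a * b) r} =
      b ^ m * zeroCount f a := by
  let π : (Fin m → ZMod (a * b)) →+ (Fin m → ZMod a) :=
    ((ZMod.castHom (Dvd.intro _ rfl) (ZMod a)).toAddMonoidHom).compLeft (Fin m)
  have hπz : ∀ z : Fin m → ℤ, π (fun i => (z i : ZMod (a * b))) = fun i => (z i : ZMod a) := by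
    intro z; ext i
    exact map_intCast (ZMod.castHom (Dvd.intro _ rfl) (ZMod a)) (z i)
  have hπ : Function.Surjective π := fun r => by
    obtain ⟨z, rfl⟩ := exists_int_lift _ r
    exact ⟨_, hπz z⟩
  have key := card_subtype_comp_mul_card π hπ (fun r => modRed f a r = 0)
  have h1 : ∀ r : Fin m → ZMod (a * b),
      (a : ZMod (a * b)) ∣ modRed f (a * b) r ↔ modRed f a (π r) = 0 := by
    intro r
    obtain ⟨z, rfl⟩ := exists_int_lift _ r
    rw [hπz, modRed_intCast hf, modRed_intCast hf, ZMod.intCast_zmod_eq_zero_iff_dvd]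
    constructor
    · rintro ⟨c, hc⟩
      obtain ⟨c, rfl⟩ := ZMod.intCast_surjective c
      have h : ((f z : ℤ) : ZMod (a * b)) = ((a * c : ℤ) : ZMod (a * b)) := by
        rw [hc]; push_cast; rfl
      rw [ZMod.intCast_eq_intCast_iff_dvd_sub] at h
      push_cast at h
      exact (dvd_sub_right (Dvd.intro _ rfl)).1 ((Dvd.intro _ rfl).trans h)
    · rintro ⟨c, hc⟩
      exact ⟨(c : ZMod (a * b)), by rw [hc]; push_cast; rfl⟩
  rw [Nat.card_congr (Equiv.subtypeEquivRight h1)]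
  simp only [Nat.card_pi, Nat.card_zmod, Finset.prod_const, Finset.card_univ, Fintype.card_fin]
    at key
  have h0 : 0 < a ^ m := pow_pos (Nat.pos_of_ne_zero ha) m
  apply Nat.eq_of_mul_eq_mul_right h0
  rw [key, mul_pow, zeroCount]; ring

/-- If a rescaling about a point `γ = g / N` acts on `f` as on `Q(r - γ) + n`, the number of zeros
modulo powers of `p` is eventually a geometric progression. -/
lemma zeroCount_prime_pow_succ (hm : 1 ≤ m) {f : (Fin m → ℤ) → ℤ}
    (hf : ∀ r u a, a ∣ f (r + a • u) - f r) (N t T : ℤ) (g : Fin m → ℤ)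
    (hscale : ∀ K r, f (r + K • (N • r - g)) = (1 + K * N) ^ 2 * f r - K * t - K ^ 2 * T)
    {p : ℕ} (hp : p.Prime) {e ν : ℕ} {u : ℤ} (ht : t = p ^ e * u) (hu : ¬ (p : ℤ) ∣ u)
    (hν : 2 * e + 1 ≤ ν) :
    zeroCount f (p ^ (ν + 1)) = p ^ (m - 1) * zeroCount f (p ^ ν) := by
  have := Fact.mk hp
  have : NeZero p := ⟨hp.ne_zero⟩
  have hlift := card_dvd_eq_pow_mul_zeroCount hf (p ^ ν) p (pow_ne_zero _ hp.ne_zero)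
  rw [← pow_succ] at hlift
  set q := p ^ (ν + 1) with hq
  have : NeZero q := ⟨pow_ne_zero _ hp.ne_zero⟩
  have hqp : ((p : ZMod q)) ^ (ν + 1) = 0 := by
    rw [← Nat.cast_pow]; exact ZMod.natCast_self _
  let φ : ℕ → (Fin m → ZMod q) → (Fin m → ZMod q) := fun k r i =>
    r i + k * p ^ (ν - e) * (N * r i - g i)
  have hφ : ∀ k r, modRed f q (φ k r) =
      (1 + k * p ^ (ν - e) * N) ^ 2 * modRed f q r - p ^ ν * (k * u) := by
    intro k r
    obtain ⟨z, rfl⟩ := exists_int_lift _ r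
    have h1 : φ k (fun i => (z i : ZMod q)) =
        fun i => (((z + (k * p ^ (ν - e) : ℤ) • (N • z - g)) i : ℤ) : ZMod q) := by
      ext i; simp [φ]
    rw [h1, modRed_intCast hf, modRed_intCast hf, hscale, ht]
    have h2 : (p : ZMod q) ^ (ν - e) * p ^ e = p ^ ν := by
      rw [← pow_add]; congr 1; omega
    have h3 : ((p : ZMod q) ^ (ν - e)) ^ 2 = 0 := by
      rw [← pow_mul, show (ν - e) * 2 = (ν + 1) + ((ν - e) * 2 - (ν + 1)) by omega, pow_add, hqp,
        zero_mul]
    push_cast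
    linear_combination (-(k : ZMod q) * u) * h2 - (k : ZMod q) ^ 2 * T * h3
  have hp1 : (p : ZMod q) ^ (ν - e) * p ^ ν = 0 := by
    rw [← pow_add, show ν - e + ν = (ν + 1) + (ν - e + ν - (ν + 1)) by omega, pow_add, hqp,
        zero_mul]
  have hunit : ∀ k : ℕ, IsUnit (1 + k * p ^ (ν - e) * N : ZMod q) := fun k => by
    apply IsNilpotent.isUnit_one_add
    refine ⟨2 * (ν + 1), ?_⟩
    have : ∃ d, (ν - e) = d + 1 := ⟨ν - e - 1, by omega⟩
    obtain ⟨d, hd⟩ := this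
    rw [hd, pow_succ, pow_mul']
    have : (k * (p ^ d * p) * N : ZMod q) ^ (ν + 1) = 0 := by
      rw [mul_pow, mul_pow, mul_pow, hqp]; ring
    rw [this]; simp
  have hinj : ∀ k, Function.Injective (φ k) := fun k r r' h => by
    ext i
    have h1 := congrFun h i
    simp only [φ] at h1
    apply (hunit k).mul_left_cancel
    linear_combination h1
  have hpk : ∀ x : ℤ, (p : ZMod q) ^ ν * x = 0 ↔ (p : ℤ) ∣ x := fun x => by
    have : ((p : ZMod q) ^ ν * x) = ((p ^ ν * x : ℤ) : ZMod q) := by push_cast; rfl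
    rw [this, ZMod.intCast_zmod_eq_zero_iff_dvd, hq]
    push_cast
    rw [pow_succ]
    exact mul_dvd_mul_iff_left (pow_ne_zero _ (by exact_mod_cast hp.ne_zero))
  have hbij : Function.Bijective (fun x : Fin p × {r : Fin m → ZMod q // modRed f q r = 0} =>
      (⟨φ x.1 x.2.1, by
        rw [hφ, x.2.2]
        exact ⟨-((x.1 : ℕ) * u), by push_cast; ring⟩⟩ :
        {r : Fin m → ZMod q // ((p ^ ν : ℕ) : ZMod q) ∣ modRed f q r})) := by
    constructor
    · rintro ⟨k, r, hr⟩ ⟨k', r', hr'⟩ h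
      have h1 : φ k r = φ k' r' := congrArg Subtype.val h
      have h2 := congrArg (modRed f q) h1
      rw [hφ, hφ, hr, hr'] at h2
      have h3 : (p : ZMod q) ^ ν * ((((k : ℕ) - (k' : ℕ)) * u : ℤ)) = 0 := by
        push_cast; linear_combination -h2
      rw [hpk] at h3
      have h4 := ((Nat.prime_iff_prime_int.1 hp).dvd_or_dvd h3).resolve_right hu
      have h5 : k = k' := by
        have := Int.eq_zero_of_abs_lt_dvd h4 (by
          have := k.2; have := k'.2; rw [abs_lt]; omega)
        ext; omega
      subst h5
      have h6 := hinj _ h1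
      subst h6
      rfl
    · rintro ⟨r, hr⟩
      obtain ⟨y, hy⟩ := hr
      obtain ⟨y, rfl⟩ := ZMod.intCast_surjective y
      push_cast at hy
      have hup : IsCoprime u (p : ℤ) :=
        ((Nat.prime_iff_prime_int.1 hp).coprime_iff_not_dvd.2 hu).symm
      obtain ⟨a, b, hab⟩ := hup
      set k : ZMod p := ((-(y * a) : ℤ) : ZMod p) with hk
      obtain ⟨r', hr'⟩ := (Finite.injective_iff_surjective.1 (hinj k.val)) r
      have hky : (p : ℤ) ∣ y + k.val * u := by
        rw [← ZMod.intCast_zmod_eq_zero_iff_dvd]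
        have h1 : ((a * u + b * p : ℤ) : ZMod p) = 1 := by rw [hab]; simp
        push_cast at h1 ⊢
        rw [ZMod.natCast_zmod_val, hk]
        push_cast
        simp only [CharP.cast_eq_zero, mul_zero, add_zero] at h1
        linear_combination (-(y : ZMod p)) * h1
      have h0 := hφ k.val r'
      rw [hr', hy] at h0
      have hky' := (hpk _).2 hky
      push_cast at hky'
      have h1 : (1 + (k.val : ℕ) * p ^ (ν - e) * N : ZMod q) ^ 2 * modRed f q r' = 0 := by
        linear_combination hky' - h0
      have h2 := ((hunit k.val).pow 2).mul_right_eq_zero.1 h1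
      refine ⟨(⟨k.val, ZMod.val_lt k⟩, ⟨r', h2⟩), Subtype.ext hr'⟩
  have hcard := Nat.card_congr (Equiv.ofBijective _ hbij)
  rw [hlift, Nat.card_prod, Nat.card_fin] at hcard
  change p * zeroCount f q = _ at hcard
  apply Nat.eq_of_mul_eq_mul_left hp.pos
  rw [hcard, ← mul_assoc, ← pow_succ', Nat.sub_add_cancel hm]

lemma bil_add_left (S : Matrix (Fin m) (Fin m) ℤ) (x y z : Fin m → ℚ) :
    bil S (x + y) z = bil S x z + bil S y z := by simp [bil, add_dotProduct]

lemma bil_add_right (S : Matrix (Fin m) (Fin m) ℤ) (x y z : Fin m → ℚ) :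
    bil S x (y + z) = bil S x y + bil S x z := by simp [bil, mulVec_add, dotProduct_add]

lemma bil_smul_left (S : Matrix (Fin m) (Fin m) ℤ) (a : ℚ) (x y : Fin m → ℚ) :
    bil S (a • x) y = a * bil S x y := by simp [bil]

lemma bil_smul_right (S : Matrix (Fin m) (Fin m) ℤ) (a : ℚ) (x y : Fin m → ℚ) :
    bil S x (a • y) = a * bil S x y := by simp [bil, mulVec_smul]

lemma bil_comm {S : Matrix (Fin m) (Fin m) ℤ} (hS : S.IsSymm) (x y : Fin m → ℚ) :
    bil S x y = bil S y x := by
  have h : (S.map (Int.cast : ℤ → ℚ))ᵀ = S.map (Int.cast : ℤ → ℚ) := by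
    rw [← transpose_map, hS.eq]
  unfold bil
  rw [dotProduct_mulVec, dotProduct_comm, ← mulVec_transpose, h]

lemma bil_intCast (S : Matrix (Fin m) (Fin m) ℤ) (x y : Fin m → ℤ) :
    bil S (fun i => (x i : ℚ)) (fun i => (y i : ℚ)) = ((x ⬝ᵥ S.mulVec y : ℤ) : ℚ) := by
  simp [bil, dotProduct, mulVec]

lemma Qf_smul (S : Matrix (Fin m) (Fin m) ℤ) (a : ℚ) (x : Fin m → ℚ) :
    Qf S (a • x) = a ^ 2 * Qf S x := by
  simp only [Qf, bil_smul_left, bil_smul_right]; ring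

lemma Qf_add {S : Matrix (Fin m) (Fin m) ℤ} (hS : S.IsSymm) (x y : Fin m → ℚ) :
    Qf S (x + y) = Qf S x + bil S x y + Qf S y := by
  simp only [Qf, bil_add_left, bil_add_right, bil_comm hS y x]; ring

lemma exists_Qf_intCast {S : Matrix (Fin m) (Fin m) ℤ} (hS : S.IsSymm) (hSeven : ∀ i, 2 ∣ S i i)
    (x : Fin m → ℤ) : ∃ z : ℤ, Qf S (fun i => (x i : ℚ)) = z := by
  have h : (2 : ℤ) ∣ x ⬝ᵥ S.mulVec x := by
    rw [← Nat.cast_two, ← ZMod.intCast_zmod_eq_zero_iff_dvd]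
    simp only [dotProduct, mulVec, Finset.mul_sum]
    rw [← Finset.sum_product']
    push_cast
    refine Finset.sum_involution (fun a _ => a.swap) ?_ ?_ (by simp) (by simp)
    · rintro ⟨i, j⟩ -
      have : S j i = S i j := hS.apply i j
      simp only [Prod.fst_swap, Prod.snd_swap, this]
      rw [show ((x j : ZMod 2) * ((S i j : ZMod 2) * (x i : ZMod 2))) =
        (x i : ZMod 2) * ((S i j : ZMod 2) * (x j : ZMod 2)) by ring]
      exact CharTwo.add_self_eq_zero _
    · rintro ⟨i, j⟩ - h1 h2
      obtain rfl : j = i := congrArg Prod.fst h2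
      apply h1
      have : (S j j : ZMod 2) = 0 := by
        rw [ZMod.intCast_zmod_eq_zero_iff_dvd]; exact_mod_cast hSeven j
      simp [this]
  obtain ⟨z, hz⟩ := h
  refine ⟨z, ?_⟩
  rw [Qf, bil_intCast, hz]; push_cast; ring

/-- The polynomial `r ↦ Q(r - γ) + n` is integer-valued on `ℤ^m`. -/
lemma exists_shifted_form {S : Matrix (Fin m) (Fin m) ℤ} (hS : S.IsSymm)
    (hSeven : ∀ i, 2 ∣ S i i) {γ : Fin m → ℚ} (hγ : memDual S γ) {n : ℚ}
    (hn : ∃ z : ℤ, n + Qf S γ = z) :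
    ∃ f : (Fin m → ℤ) → ℤ, (∀ r, (f r : ℚ) = Qf S ((fun i => (r i : ℚ)) - γ) + n) ∧
      ∀ r u a, a ∣ f (r + a • u) - f r := by
  have h : ∀ r : Fin m → ℤ, ∃ z : ℤ, (z : ℚ) = Qf S ((fun i => (r i : ℚ)) - γ) + n := fun r => by
    obtain ⟨z, hz⟩ := hn
    obtain ⟨z', hz'⟩ := exists_Qf_intCast hS hSeven r
    obtain ⟨z'', hz''⟩ := hγ r
    refine ⟨z' - z'' + z, ?_⟩
    have h1 : (fun i => (r i : ℚ)) - γ = (fun i => (r i : ℚ)) + (-1 : ℚ) • γ := by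
      ext; simp; ring
    rw [h1, Qf_add hS, bil_smul_right, Qf_smul, hz', bil_comm hS, hz'']
    push_cast
    linear_combination -hz
  choose f hf using h
  refine ⟨f, hf, fun r u a => ?_⟩
  obtain ⟨z', hz'⟩ := exists_Qf_intCast hS hSeven u
  obtain ⟨z'', hz''⟩ := hγ u
  refine ⟨r ⬝ᵥ S.mulVec u - z'' + a * z', ?_⟩
  have h1 : (fun i => (((r + a • u) i : ℤ) : ℚ)) - γ =
      ((fun i => (r i : ℚ)) - γ) + (a : ℚ) • (fun i => (u i : ℚ)) := by
    ext; simp; ring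
  have h2 : (fun i => (r i : ℚ)) - γ = (fun i => (r i : ℚ)) + (-1 : ℚ) • γ := by
    ext; simp; ring
  have h3 : bil S ((fun i => (r i : ℚ)) - γ) (fun i => (u i : ℚ)) =
      ((r ⬝ᵥ S.mulVec u : ℤ) : ℚ) - z'' := by
    rw [h2, bil_add_left, bil_smul_left, bil_intCast, hz'']; ring
  have h4 : ((f (r + a • u) - f r : ℤ) : ℚ) =
      ((a * (r ⬝ᵥ S.mulVec u - z'' + a * z') : ℤ) : ℚ) := by
    rw [Int.cast_sub, hf, hf, h1, Qf_add hS, Qf_smul, bil_smul_right, hz', h3]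
    push_cast; ring
  exact_mod_cast h4

lemma repNum_eq_zeroCount {S : Matrix (Fin m) (Fin m) ℤ} {γ : Fin m → ℚ} {n : ℚ}
    {f : (Fin m → ℤ) → ℤ} (hf : ∀ r, (f r : ℚ) = Qf S ((fun i => (r i : ℚ)) - γ) + n)
    {a : ℕ} (ha : a ≠ 0) : repNum S γ n a = zeroCount f a := by
  obtain ⟨k, rfl⟩ := Nat.exists_eq_succ_of_ne_zero ha
  refine Nat.card_congr (Equiv.subtypeEquivRight fun r : Fin m → ZMod (k + 1) => ?_)
  rw [modRed, ZMod.intCast_zmod_eq_zero_iff_dvd]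
  have h1 := hf fun i => ((r i).cast : ℤ)
  have h2 : (fun i => (((r i).cast : ℤ) : ℚ)) = fun i => ((Fin.val (r i) : ℕ) : ℚ) := by
    ext i; rfl
  rw [h2] at h1
  constructor
  · rintro ⟨t, ht⟩
    exact ⟨t, by exact_mod_cast h1.trans ht⟩
  · rintro ⟨t, ht⟩
    exact ⟨t, by rw [← h1, ht]; push_cast; rfl⟩

/-- Stabilization of representation numbers modulo high powers of a prime. -/
lemma repNum_prime_pow_succ (hm : 1 ≤ m) {S : Matrix (Fin m) (Fin m) ℤ} (hS : S.IsSymm)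
    (hSeven : ∀ i, 2 ∣ S i i) {γ : Fin m → ℚ} (hγ : memDual S γ) {n : ℚ}
    (hn : ∃ z : ℤ, n + Qf S γ = z) (hn0 : n ≠ 0) {Nγ : ℕ} (hNγ : isOrderOf γ Nγ)
    {M : ℕ} (hM : M ≠ 0) {t : ℤ} (ht : (t : ℚ) = 2 * M * Nγ * n) {p : ℕ} (hp : p.Prime) {ν : ℕ}
    (hν : 1 + 2 * padicValInt p t ≤ ν) :
    repNum S γ n (p ^ (ν + 1)) = p ^ (m - 1) * repNum S γ n (p ^ ν) := by
  have := Fact.mk hp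
  obtain ⟨f, hf, hper⟩ := exists_shifted_form hS hSeven hγ hn
  rw [repNum_eq_zeroCount hf (pow_ne_zero _ hp.ne_zero),
    repNum_eq_zeroCount hf (pow_ne_zero _ hp.ne_zero)]
  obtain ⟨z, hz⟩ := hn
  obtain ⟨hN0, hg, -⟩ := hNγ
  choose g hg using hg
  have hg' : (Nγ : ℚ) • γ = fun i => (g i : ℚ) := by ext i; simp [hg]
  obtain ⟨z1, hz1⟩ := hγ g
  obtain ⟨z2, hz2⟩ := exists_Qf_intCast hS hSeven g
  rw [← hg', bil_smul_right] at hz1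
  rw [← hg', Qf_smul] at hz2
  have hbQ : bil S γ γ = 2 * Qf S γ := by rw [Qf]; ring
  rw [hbQ] at hz1
  have ht0 : ((2 * Nγ * z - z1 : ℤ) : ℚ) = 2 * Nγ * n := by
    push_cast; linear_combination (-2 * (Nγ : ℚ)) * hz + hz1
  have hT : ((Nγ ^ 2 * z - z2 : ℤ) : ℚ) = Nγ ^ 2 * n := by
    push_cast; linear_combination (-(Nγ : ℚ) ^ 2) * hz + hz2
  set t0 : ℤ := 2 * Nγ * z - z1
  set T : ℤ := Nγ ^ 2 * z - z2
  have htt : t = M * t0 := by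
    have : (t : ℚ) = ((M * t0 : ℤ) : ℚ) := by rw [Int.cast_mul, ht0, ht]; push_cast; ring
    exact_mod_cast this
  have ht00 : t0 ≠ 0 := by
    intro h
    rw [h, Int.cast_zero, eq_comm] at ht0
    simp [hn0, hN0.ne'] at ht0
  have hle : padicValInt p t0 ≤ padicValInt p t := by
    rw [htt, padicValInt.mul (by exact_mod_cast hM) ht00]; omega
  obtain ⟨u, hu⟩ := padicValInt_dvd (p := p) t0
  refine zeroCount_prime_pow_succ hm hper Nγ t0 T g (fun K r => ?_) hp hu ?_ (by omega)
  · have h1 : (fun i => (((r + K • ((Nγ : ℤ) • r - g)) i : ℤ) : ℚ)) - γ =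
        (1 + K * Nγ : ℚ) • ((fun i => (r i : ℚ)) - γ) := by
      ext i; simp [← hg]; ring
    have h2 : ((f (r + K • ((Nγ : ℤ) • r - g)) : ℤ) : ℚ) =
        (((1 + K * Nγ) ^ 2 * f r - K * t0 - K ^ 2 * T : ℤ) : ℚ) := by
      push_cast
      rw [hf, h1, Qf_smul, hf, ht0, hT]; ring
    exact_mod_cast h2
  · rintro ⟨v, rfl⟩
    have h1 : ((p : ℤ)) ^ (padicValInt p t0 + 1) ∣ t0 := ⟨v, by
      conv_lhs => rw [hu]
      ring⟩
    rw [padicValInt_dvd_iff] at h1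
    rcases h1 with h1 | h1
    · exact ht00 h1
    · omega

/-- The normalized arithmetic function `a ↦ a^{1-m} R(a)`. -/
noncomputable def normalizedCount (m : ℕ) (R : ℕ → ℕ) : ArithmeticFunction ℂ where
  toFun a := if a = 0 then 0 else (a : ℂ) ^ ((1 : ℤ) - (m : ℤ)) * (R a : ℂ)
  map_zero' := if_pos rfl

lemma normalizedCount_apply {R : ℕ → ℕ} {a : ℕ} (ha : a ≠ 0) :
    normalizedCount m R a = (a : ℂ) ^ ((1 : ℤ) - (m : ℤ)) * (R a : ℂ) := if_neg ha

lemma isMultiplicative_normalizedCount {R : ℕ → ℕ} (h1 : R 1 = 1)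
    (hmul : ∀ a b, a ≠ 0 → b ≠ 0 → a.Coprime b → R (a * b) = R a * R b) :
    (normalizedCount m R).IsMultiplicative := by
  rw [ArithmeticFunction.IsMultiplicative.iff_ne_zero]
  refine ⟨by simp [normalizedCount_apply, h1], fun {a b} ha hb hab => ?_⟩
  rw [normalizedCount_apply ha, normalizedCount_apply hb,
    normalizedCount_apply (mul_ne_zero ha hb), hmul a b ha hb hab]
  push_cast
  rw [mul_zpow]; ring

lemma norm_normalizedCount_le {R : ℕ → ℕ} (hle : ∀ a ≠ 0, R a ≤ a ^ m) {a : ℕ} (ha : a ≠ 0) :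
    ‖normalizedCount m R a‖ ≤ a := by
  have ha' : (0 : ℝ) < a := by exact_mod_cast Nat.pos_of_ne_zero ha
  rw [normalizedCount_apply ha, norm_mul, norm_zpow, Complex.norm_natCast, Complex.norm_natCast]
  calc (a : ℝ) ^ ((1 : ℤ) - (m : ℤ)) * R a ≤ (a : ℝ) ^ ((1 : ℤ) - (m : ℤ)) * a ^ m := by
        gcongr; exact_mod_cast hle a ha
    _ = a := by
        rw [← zpow_natCast, ← zpow_add₀ ha'.ne']; simp

lemma mul_moebius_apply (h : ArithmeticFunction ℂ) (c : ℕ) :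
    (h * (ArithmeticFunction.moebius : ArithmeticFunction ℂ)) c =
      ∑ a ∈ c.divisors, (ArithmeticFunction.moebius (c / a) : ℂ) * h a := by
  rw [ArithmeticFunction.mul_apply,
    Nat.sum_divisorsAntidiagonal fun a b =>
      h a * (ArithmeticFunction.moebius : ArithmeticFunction ℂ) b]
  exact Finset.sum_congr rfl fun a _ => by rw [ArithmeticFunction.intCoe_apply, mul_comm]

lemma mul_moebius_apply_prime_pow_succ (h : ArithmeticFunction ℂ) {p : ℕ} (hp : p.Prime) (k : ℕ) :
    (h * (ArithmeticFunction.moebius : ArithmeticFunction ℂ)) (p ^ (k + 1)) =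
      h (p ^ (k + 1)) - h (p ^ k) := by
  set G := h * (ArithmeticFunction.moebius : ArithmeticFunction ℂ) with hG
  have h1 : G * (ArithmeticFunction.zeta : ArithmeticFunction ℂ) = h := by
    rw [hG, mul_assoc, ArithmeticFunction.coe_moebius_mul_coe_zeta, mul_one]
  have h2 : ∀ k, h (p ^ k) = ∑ i ∈ range (k + 1), G (p ^ i) := fun k => by
    conv_lhs => rw [← h1]
    rw [ArithmeticFunction.coe_mul_zeta_apply, Nat.sum_divisors_prime_pow hp]
  rw [h2, h2, Finset.sum_range_succ _ (k + 1)]; ring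

lemma natCast_pow_cpow (p k : ℕ) (s : ℂ) : ((p ^ k : ℕ) : ℂ) ^ s = ((p : ℂ) ^ s) ^ k := by
  induction k with
  | zero => simp
  | succ k ih => rw [pow_succ, Nat.cast_mul, Complex.natCast_mul_natCast_cpow, ih, pow_succ]

/-- Coefficients with a linear recurrence of order one sum to a polynomial Euler factor. -/
lemma sum_range_sub_shift (a : ℕ → ℂ) (b : ℕ → ℂ) (y : ℂ) (h0 : b 0 = a 0)
    (h : ∀ k, b (k + 1) = a (k + 1) - y * a k) (w : ℕ) :
    ∑ e ∈ range (w + 1), b e = a w + (1 - y) * ∑ e ∈ range w, a e := by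
  induction w with
  | zero => simp [h0]
  | succ w ih => rw [Finset.sum_range_succ, ih, h, Finset.sum_range_succ _ w]; ring

/-- The twisted Dirichlet series coefficient attached to a counting function `R`. -/
noncomputable def twistedTerm (m : ℕ) (R : ℕ → ℕ) {N : ℕ} (χ : DirichletCharacter ℂ N) (g : ℕ)
    (s : ℂ) (c : ℕ) : ℂ :=
  if c ≠ 0 ∧ Nat.Coprime c g then
    χ (c : ZMod N) * (c : ℂ) ^ (-s) *
      (normalizedCount m R * (ArithmeticFunction.moebius : ArithmeticFunction ℂ)) c
  else 0

lemma twistedTerm_mul {R : ℕ → ℕ} (h1 : R 1 = 1)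
    (hmul : ∀ a b, a ≠ 0 → b ≠ 0 → a.Coprime b → R (a * b) = R a * R b)
    {N : ℕ} (χ : DirichletCharacter ℂ N) (g : ℕ) (s : ℂ) {a b : ℕ} (hab : a.Coprime b) :
    twistedTerm m R χ g s (a * b) = twistedTerm m R χ g s a * twistedTerm m R χ g s b := by
  have hG := (isMultiplicative_normalizedCount (m := m) h1 hmul).mul
    (ArithmeticFunction.isMultiplicative_moebius.intCast (R := ℂ))
  unfold twistedTerm
  by_cases ha : a ≠ 0 ∧ Nat.Coprime a g
  · by_cases hb : b ≠ 0 ∧ Nat.Coprime b g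
    · rw [if_pos ha, if_pos hb, if_pos ⟨mul_ne_zero ha.1 hb.1, ha.2.mul_left hb.2⟩,
        hG.map_mul_of_coprime hab, Nat.cast_mul, Nat.cast_mul, map_mul,
        Complex.natCast_mul_natCast_cpow]
      ring
    · rw [if_neg hb, mul_zero, if_neg]
      exact fun h => hb ⟨right_ne_zero_of_mul h.1, (Nat.coprime_mul_iff_left.1 h.2).2⟩
  · rw [if_neg ha, zero_mul, if_neg]
    exact fun h => ha ⟨left_ne_zero_of_mul h.1, (Nat.coprime_mul_iff_left.1 h.2).1⟩

lemma twistedTerm_one {R : ℕ → ℕ} (h1 : R 1 = 1)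
    {N : ℕ} (χ : DirichletCharacter ℂ N) (g : ℕ) (s : ℂ) : twistedTerm m R χ g s 1 = 1 := by
  simp [twistedTerm, normalizedCount_apply, h1]

lemma summable_norm_twistedTerm {R : ℕ → ℕ} (hle : ∀ a ≠ 0, R a ≤ a ^ m)
    {N : ℕ} (χ : DirichletCharacter ℂ N) (g : ℕ) {s : ℂ} (hs : 2 < s.re) :
    Summable fun c => ‖twistedTerm m R χ g s c‖ := by
  have hh : LSeriesSummable (fun c => normalizedCount m R c) s := by
    refine LSeriesSummable_of_le_const_mul_rpow hs ⟨1, fun c hc => ?_⟩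
    rw [show (2 : ℝ) - 1 = 1 by norm_num, Real.rpow_one, one_mul]
    exact norm_normalizedCount_le hle hc
  have hμ := ArithmeticFunction.LSeriesSummable_moebius_iff.2 (show 1 < s.re by linarith)
  have hsum := (ArithmeticFunction.LSeriesSummable_mul hh
    (g := (ArithmeticFunction.moebius : ArithmeticFunction ℂ)) (by simpa using hμ)).norm
  refine hsum.of_nonneg_of_le (fun _ => norm_nonneg _) fun c => ?_
  unfold twistedTerm
  split_ifs with hc
  · rw [LSeries.term_def₀ (by simp), mul_assoc, norm_mul]
    rw [mul_comm (c ^ (-s) : ℂ)]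
    exact mul_le_of_le_one_left (norm_nonneg _) (χ.norm_le_one _)
  · simp

lemma tsum_twistedTerm_of_dvd {R : ℕ → ℕ} (h1 : R 1 = 1) {N : ℕ} (χ : DirichletCharacter ℂ N)
    {g : ℕ} (s : ℂ) {p : ℕ} (hp : p.Prime) (hpg : p ∣ g) :
    ∑' e, twistedTerm m R χ g s (p ^ e) = 1 := by
  rw [tsum_eq_single 0, pow_zero, twistedTerm_one h1]
  intro e he
  refine if_neg fun h => ?_
  have := Nat.Coprime.coprime_dvd_left (dvd_pow_self p he) h.2
  exact (hp.coprime_iff_not_dvd.1 this) hpg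

lemma tsum_twistedTerm_of_not_dvd (hm : 1 ≤ m) {R : ℕ → ℕ} (h1 : R 1 = 1) {N : ℕ}
    (χ : DirichletCharacter ℂ N) {g : ℕ} (s : ℂ) {p : ℕ} (hp : p.Prime) (hpg : ¬ p ∣ g) {w : ℕ}
    (hw : ∀ ν, w ≤ ν → R (p ^ (ν + 1)) = p ^ (m - 1) * R (p ^ ν)) {X : ℂ}
    (hX : X = χ (p : ZMod N) * (p : ℂ) ^ ((1 : ℂ) - (m : ℂ) - s)) :
    ∑' e, twistedTerm m R χ g s (p ^ e) =
      (R (p ^ w) : ℂ) * X ^ w +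
        (1 - (p : ℂ) ^ (m - 1) * X) * ∑ ν ∈ range w, (R (p ^ ν) : ℂ) * X ^ ν := by
  have hp0 : (p : ℂ) ≠ 0 := by exact_mod_cast hp.ne_zero
  set q : ℂ := (p : ℂ) ^ (m - 1) with hq
  have hq0 : q ≠ 0 := pow_ne_zero _ hp0
  have hqz : (p : ℂ) ^ ((1 : ℤ) - (m : ℤ)) = q⁻¹ := by
    rw [hq, ← zpow_natCast, ← _root_.zpow_neg]; congr 1; omega
  have hqX : q * X = χ (p : ZMod N) * (p : ℂ) ^ (-s) := by
    rw [hX, show (1 : ℂ) - m - s = ((1 - m : ℤ) : ℂ) + (-s) by push_cast; ring,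
      Complex.cpow_add _ _ hp0, Complex.cpow_intCast, hqz]
    field_simp
  have hcoef : ∀ k, (χ ((p ^ k : ℕ) : ZMod N) : ℂ) * ((p ^ k : ℕ) : ℂ) ^ (-s) = (q * X) ^ k := by
    intro k
    rw [natCast_pow_cpow, hqX, Nat.cast_pow, map_pow, mul_pow]
  have hcount : ∀ k, normalizedCount m R (p ^ k) = q⁻¹ ^ k * R (p ^ k) := by
    intro k
    rw [normalizedCount_apply (pow_ne_zero _ hp.ne_zero), ← hqz, Nat.cast_pow,
      ← zpow_natCast, ← zpow_natCast, ← _root_.zpow_mul, ← _root_.zpow_mul, mul_comm]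
    ring_nf
  have hsucc : ∀ k, twistedTerm m R χ g s (p ^ (k + 1)) =
      R (p ^ (k + 1)) * X ^ (k + 1) - q * X * (R (p ^ k) * X ^ k) := by
    intro k
    rw [twistedTerm, if_pos ⟨pow_ne_zero _ hp.ne_zero,
      Nat.Coprime.pow_left _ (hp.coprime_iff_not_dvd.2 hpg)⟩, hcoef,
      mul_moebius_apply_prime_pow_succ _ hp, hcount, hcount]
    have h2 : q ^ k * q⁻¹ ^ k = 1 := by rw [← mul_pow, mul_inv_cancel₀ hq0, one_pow]
    have h3 : q * q⁻¹ = 1 := mul_inv_cancel₀ hq0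
    rw [mul_pow, pow_succ q, pow_succ q⁻¹]
    linear_combination (X ^ (k + 1) * (R (p ^ (k + 1)) * (q * q⁻¹) - q * R (p ^ k))) * h2 +
      X ^ (k + 1) * R (p ^ (k + 1)) * h3
  rw [tsum_eq_sum (s := range (w + 1)),
    sum_range_sub_shift (fun e => (R (p ^ e) : ℂ) * X ^ e) _ (q * X) _ hsucc]
  · simp [twistedTerm_one h1, h1]
  · intro e he
    obtain ⟨k, rfl⟩ : ∃ k, e = k + 1 := ⟨e - 1, by simp at he; omega⟩
    rw [hsucc, hw k (by simp at he; omega)]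
    push_cast
    ring

/-- Euler product for the twisted Dirichlet series of representation
numbers: for `Re(s) > m + 1`, both sides converge absolutely and
`∑_{c≥1, (c,g)=1} χ(c)c^{−s}∑_{a∣c}μ(c/a)a^{1−m}N_{γ,n}(a)
  = ∏_{p ∤ g} L^{(p)}(χ(p)p^{1−m−s})`. -/
theorem euler_product (m : ℕ) (hm : 1 ≤ m) (S : Matrix (Fin m) (Fin m) ℤ)
    (hSsymm : S.IsSymm) (hSeven : ∀ i, 2 ∣ S i i) (hSdet : S.det ≠ 0)
    (γ : Fin m → ℚ) (hγ : memDual S γ) (n : ℚ) (hn : ∃ z : ℤ, n + Qf S γ = z)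
    (hn0 : n ≠ 0)
    (β : Fin m → ℚ) (hβ : memDual S β) (hβiso : ∃ z : ℤ, Qf S β = z)
    (Nβ : ℕ) (hNβ : isOrderOf β Nβ)
    (χ : DirichletCharacter ℂ Nβ)
    (b : ℤ) (hb : (b : ℚ) = Nβ * bil S γ β)
    (Nγ : ℕ) (hNγ : isOrderOf γ Nγ)
    (t : ℤ) (ht : (t : ℚ) = 2 * Nβ * Nγ * n)
    (s : ℂ) (hs : (m : ℝ) + 1 < s.re)
    (F : ℕ → ℂ)
    (hF : ∀ c : ℕ, F c =
      if c ≠ 0 ∧ Nat.Coprime c (Int.gcd (Nβ : ℤ) b) then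
        χ ((c : ℕ) : ZMod Nβ) * (c : ℂ) ^ (-s) *
          ∑ a ∈ c.divisors, (ArithmeticFunction.moebius (c / a) : ℂ) *
            (a : ℂ) ^ ((1 : ℤ) - (m : ℤ)) * (repNum S γ n a : ℂ)
      else 0)
    (P : {p : Nat.Primes // ¬ (p : ℕ) ∣ Int.gcd (Nβ : ℤ) b} → ℂ)
    (hP : ∀ p, P p =
      Lpoly S γ n (p : ℕ) (1 + 2 * padicValInt (p : ℕ) t)
        (χ (((p : ℕ) : ℕ) : ZMod Nβ) * ((p : ℕ) : ℂ) ^ ((1 : ℂ) - (m : ℂ) - s))) :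
    Summable (fun c : ℕ => ‖F c‖) ∧ Multipliable P ∧ ∑' c : ℕ, F c = ∏' p, P p := by
  have hs2 : 2 < s.re := by
    have : (1 : ℝ) ≤ m := by exact_mod_cast hm
    linarith
  have hNβ0 : Nβ ≠ 0 := hNβ.1.ne'
  set R := repNum S γ n
  obtain ⟨f, hf, hper⟩ := exists_shifted_form hSsymm hSeven hγ hn
  have hRf : ∀ a ≠ 0, R a = zeroCount f a := fun a ha => repNum_eq_zeroCount hf ha
  have hR1 : R 1 = 1 := by rw [hRf 1 one_ne_zero, zeroCount_one]
  have hRmul : ∀ a b, a ≠ 0 → b ≠ 0 → a.Coprime b → R (a * b) = R a * R b :=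
    fun a b ha hb hab => by
      rw [hRf _ (mul_ne_zero ha hb), hRf a ha, hRf b hb, zeroCount_mul hper hab]
  have hRle : ∀ a ≠ 0, R a ≤ a ^ m := fun a ha => hRf a ha ▸ zeroCount_le f a ha
  have hFt : F = twistedTerm m R χ (Int.gcd (Nβ : ℤ) b) s := by
    ext c
    rw [hF, twistedTerm, mul_moebius_apply]
    refine if_congr Iff.rfl ?_ rfl
    congr 1
    refine Finset.sum_congr rfl fun a ha => ?_
    rw [normalizedCount_apply (Nat.pos_of_mem_divisors ha).ne', mul_assoc]
  have hsum : Summable fun c => ‖F c‖ := by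
    rw [hFt]; exact summable_norm_twistedTerm hRle χ (Int.gcd (Nβ : ℤ) b) hs2
  have hprod := EulerProduct.eulerProduct_hasProd (f := F)
    (by rw [hFt]; exact twistedTerm_one hR1 χ (Int.gcd (Nβ : ℤ) b) s)
    (fun {x y} hxy => by rw [hFt]; exact twistedTerm_mul hR1 hRmul χ (Int.gcd (Nβ : ℤ) b) s hxy)
    hsum (by simp [hF])
  have hsub := (hasProd_subtype_iff_of_mulSupport_subset
    (s := {p : Nat.Primes | ¬ (p : ℕ) ∣ Int.gcd (Nβ : ℤ) b}) fun p hp hpg => hp (by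
      rw [hFt]; exact tsum_twistedTerm_of_dvd hR1 χ s p.2 hpg)).2 hprod
  have hPe : P = (fun p : Nat.Primes => ∑' e, F ((p : ℕ) ^ e)) ∘
      ((↑) : {p : Nat.Primes | ¬ (p : ℕ) ∣ Int.gcd (Nβ : ℤ) b} → Nat.Primes) := by
    ext p
    rw [hP, hFt]
    exact (tsum_twistedTerm_of_not_dvd hm hR1 χ s p.1.2 p.2
      (fun ν hν => repNum_prime_pow_succ hm hSsymm hSeven hγ hn hn0 hNγ hNβ0 ht p.1.2 hν) rfl).symm
  rw [← hPe] at hsub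
  exact ⟨hsum, hsub.multipliable, hsub.tprod_eq.symm⟩

end EisensteinWeil
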